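/- Let k, n, c be positive integers with 1 ≤ k ≤ 2^n. Then ν₂(S(c·2^n, k)) = s₂(k) − 1. -/

import Mathlib

/-- Stirling numbers of the second kind. -/
def S : ℕ → ℕ → ℕ
  | 0, 0 => 1
  | 0, _ + 1 => 0
  | _ + 1, 0 => 0
  | n + 1, k + 1 => S n k + (k + 1) * S n (k + 1)

/-- Sum of binary digits. -/
def s₂ (n : ℕ) : ℕ := (Nat.digits 2 n).sum

open Finset.HasAntidiagonal fwdDiff_aux

/-- The `k`-th Newton coefficient of a function on `ℕ`: its `k`-th forward difference at `0`. -/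
def newtonCoeff (k : ℕ) : (ℕ → ℤ) →ₗ[ℤ] ℤ :=
  LinearMap.proj 0 ∘ₗ (fwdDiffₗ ℕ ℤ 1) ^ k

theorem newtonCoeff_apply (k : ℕ) (f : ℕ → ℤ) : newtonCoeff k f = (fwdDiff 1)^[k] f 0 := by
  simp only [newtonCoeff, LinearMap.comp_apply, LinearMap.proj_apply, ← coe_fwdDiffₗ_pow]

theorem fwdDiff_iter_mul (k : ℕ) (f g : ℕ → ℤ) (x : ℕ) :
    (fwdDiff 1)^[k] (f * g) x = ∑ ij ∈ antidiagonal k,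
      (k.choose ij.1 : ℤ) * ((fwdDiff 1)^[ij.1] f x * (fwdDiff 1)^[ij.2] g (x + ij.1)) := by
  induction k generalizing f g with
  | zero => simp
  | succ k ih =>
    have h : fwdDiff 1 (f * g) = fwdDiff 1 f * (fun r ↦ g (r + 1)) + f * fwdDiff 1 g := by
      ext y
      simp only [fwdDiff, Pi.mul_apply, Pi.add_apply]
      ring
    rw [Function.iterate_succ_apply, h, fwdDiff_iter_add, Pi.add_apply, ih, ih,
      Finset.sum_antidiagonal_choose_succ_mul
        (fun i j ↦ (fwdDiff 1)^[i] f x * (fwdDiff 1)^[j] g (x + i)) k, add_comm]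
    congr 1
    refine Finset.sum_congr rfl fun ij hij ↦ ?_
    rw [fwdDiff_iter_comp_add, Function.iterate_succ_apply, add_assoc,
      Nat.choose_symm_of_eq_add (mem_antidiagonal.mp hij).symm]

theorem fwdDiff_iter_apply_eq_sum_newtonCoeff (j i : ℕ) (g : ℕ → ℤ) :
    (fwdDiff 1)^[j] g i = ∑ l ∈ Finset.range (i + 1), (i.choose l : ℤ) * newtonCoeff (j + l) g := by
  have h := shift_eq_sum_fwdDiff_iter 1 ((fwdDiff 1)^[j] g) i 0
  simp only [smul_eq_mul, mul_one, zero_add, nsmul_eq_mul] at h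
  rw [h]
  refine Finset.sum_congr rfl fun l _ ↦ ?_
  rw [newtonCoeff_apply, ← Function.iterate_add_apply, add_comm l j]

/-- The Leibniz rule for Newton coefficients. -/
theorem newtonCoeff_mul (k : ℕ) (f g : ℕ → ℤ) :
    newtonCoeff k (f * g) = ∑ ij ∈ antidiagonal k, (k.choose ij.1 : ℤ) *
      (newtonCoeff ij.1 f *
        ∑ l ∈ Finset.range (ij.1 + 1), (ij.1.choose l : ℤ) * newtonCoeff (ij.2 + l) g) := by
  rw [newtonCoeff_apply, fwdDiff_iter_mul]
  refine Finset.sum_congr rfl fun ij _ ↦ ?_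
  rw [zero_add, fwdDiff_iter_apply_eq_sum_newtonCoeff ij.2, ← newtonCoeff_apply]

theorem newtonCoeff_choose (k m : ℕ) :
    newtonCoeff k (fun x ↦ (x.choose m : ℤ)) = if k = m then 1 else 0 := by
  rw [newtonCoeff_apply, fwdDiff_iter_choose_zero]

theorem newtonCoeff_pow (N k : ℕ) :
    newtonCoeff k (fun x ↦ (x : ℤ) ^ N) = k.factorial * S N k := by
  induction N generalizing k with
  | zero =>
    have h := newtonCoeff_choose k 0
    simp only [Nat.choose_zero_right, Nat.cast_one] at h
    simp only [pow_zero, h]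
    cases k <;> simp [S]
  | succ N ih =>
    cases k with
    | zero => simp [S, newtonCoeff_apply]
    | succ k =>
      have h : (fun x : ℕ ↦ (x : ℤ) ^ (N + 1)) =
          (fun x ↦ (x.choose 1 : ℤ)) * fun x : ℕ ↦ (x : ℤ) ^ N := by
        ext x
        simp [pow_succ, mul_comm]
      rw [h, newtonCoeff_mul, Finset.sum_eq_single (1, k)]
      · simp only [newtonCoeff_choose, Finset.sum_range_succ, ih]
        simp [S, Nat.factorial_succ]
        ring
      · rintro ⟨i, j⟩ hij hne
        have : i ≠ 1 := by
          rintro rfl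
          apply hne
          rw [mem_antidiagonal] at hij
          ext <;> simp_all; omega
        rw [newtonCoeff_choose, if_neg this, zero_mul, mul_zero]
      · intro h
        exact absurd (mem_antidiagonal.mpr (add_comm 1 k)) h

theorem newtonCoeff_dvd_of_forall_dvd {d : ℤ} {f : ℕ → ℤ} (h : ∀ x, d ∣ f x) (k : ℕ) :
    d ∣ newtonCoeff k f := by
  choose g hg using h
  have : f = d • g := by
    ext x
    simp [hg x]
  rw [this, map_smul]
  exact Dvd.intro _ rfl

/-- The functions on `ℕ` whose `k`-th Newton coefficient is divisible by `2 ^ k` for `k ≤ m`. -/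
def dyadicSubmodule (m : ℕ) : Submodule ℤ (ℕ → ℤ) where
  carrier := {f | ∀ k ≤ m, (2 : ℤ) ^ k ∣ newtonCoeff k f}
  zero_mem' k _ := by simp
  add_mem' hf hg k hk := by
    rw [map_add]
    exact dvd_add (hf k hk) (hg k hk)
  smul_mem' c f hf k hk := by
    rw [map_smul]
    exact Dvd.dvd.mul_left (hf k hk) c

theorem mem_dyadicSubmodule {m : ℕ} {f : ℕ → ℤ} :
    f ∈ dyadicSubmodule m ↔ ∀ k ≤ m, (2 : ℤ) ^ k ∣ newtonCoeff k f := Iff.rfl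

theorem mul_mem_dyadicSubmodule {m : ℕ} {f g : ℕ → ℤ} (hf : f ∈ dyadicSubmodule m)
    (hg : g ∈ dyadicSubmodule m) : f * g ∈ dyadicSubmodule m := by
  intro k hk
  rw [newtonCoeff_mul]
  refine Finset.dvd_sum fun ⟨i, j⟩ hij ↦ ?_
  obtain rfl := mem_antidiagonal.mp hij
  refine Dvd.dvd.mul_left ?_ _
  dsimp only at hk ⊢
  rw [pow_add]
  refine mul_dvd_mul (hf i (by omega)) (Finset.dvd_sum fun l hl ↦ ?_)
  rw [Finset.mem_range] at hl
  exact Dvd.dvd.mul_left ((pow_dvd_pow 2 (by omega)).trans (hg (j + l) (by omega))) _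

/-- The indicator function of the odd numbers. -/
def oddIndicator (x : ℕ) : ℤ := (x % 2 : ℕ)

theorem oddIndicator_mul_self : oddIndicator * oddIndicator = oddIndicator := by
  ext x
  rcases Nat.mod_two_eq_zero_or_one x with h | h <;> simp [oddIndicator, h]

theorem newtonCoeff_zero_oddIndicator : newtonCoeff 0 oddIndicator = 0 := by
  simp [newtonCoeff_apply, oddIndicator]

theorem newtonCoeff_succ_oddIndicator (k : ℕ) : newtonCoeff (k + 1) oddIndicator = (-2) ^ k := by
  have h (j : ℕ) : (fwdDiff 1)^[j + 1] oddIndicator =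
      fun x ↦ (-2) ^ j * (1 - 2 * oddIndicator x) := by
    induction j with
    | zero =>
      ext x
      rcases Nat.mod_two_eq_zero_or_one x with h | h <;>
        simp [fwdDiff, oddIndicator, h, Nat.add_mod]
    | succ j ih =>
      ext x
      rw [Function.iterate_succ_apply', ih]
      rcases Nat.mod_two_eq_zero_or_one x with h | h <;>
        simp [fwdDiff, oddIndicator, h, Nat.add_mod] <;> ring
  rw [newtonCoeff_apply, h]
  simp [oddIndicator]

/-- The Newton series of `oddIndicator`, truncated at degree `K`. -/
def truncOddIndicator (K : ℕ) (x : ℕ) : ℤ :=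
  ∑ r ∈ Finset.range K, (-2) ^ r * (x.choose (r + 1) : ℤ)

theorem newtonCoeff_truncOddIndicator (K k : ℕ) :
    newtonCoeff k (truncOddIndicator K) = if k ≤ K then newtonCoeff k oddIndicator else 0 := by
  have h : truncOddIndicator K =
      ∑ r ∈ Finset.range K, ((-2) ^ r : ℤ) • fun x ↦ (x.choose (r + 1) : ℤ) := by
    ext x
    simp [truncOddIndicator]
  simp only [h, map_sum, map_smul, newtonCoeff_choose]
  cases k with
  | zero => simp [newtonCoeff_zero_oddIndicator]
  | succ k => simp [newtonCoeff_succ_oddIndicator]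

theorem neg_two_mul_newtonCoeff_truncOddIndicator (K k : ℕ) :
    -2 * newtonCoeff k (truncOddIndicator K) =
      (-2) ^ k * if 1 ≤ k ∧ k ≤ K then 1 else 0 := by
  rw [newtonCoeff_truncOddIndicator]
  cases k with
  | zero => simp [newtonCoeff_zero_oddIndicator]
  | succ k =>
    rw [newtonCoeff_succ_oddIndicator, pow_succ']
    by_cases h : k + 1 ≤ K <;> simp [h]

theorem two_smul_truncOddIndicator_mem (K m : ℕ) :
    (2 : ℤ) • truncOddIndicator K ∈ dyadicSubmodule m := by
  intro k _
  have h := neg_two_mul_newtonCoeff_truncOddIndicator K k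
  rw [map_smul, smul_eq_mul, ← dvd_neg, ← neg_mul, h]
  refine Dvd.dvd.mul_right ?_ _
  rw [neg_pow]
  exact Dvd.intro_left _ rfl

theorem sum_range_choose_succ_modEq (m t : ℕ) :
    ∑ i ∈ Finset.range (t + 1), (m + 1).choose i ≡ m.choose t [MOD 2] := by
  induction t with
  | zero => simp [Nat.ModEq]
  | succ t ih =>
    rw [Finset.sum_range_succ]
    refine (ih.add_right _).trans ?_
    rw [Nat.choose_succ_succ, ← add_assoc]
    simp [Nat.ModEq, ← two_mul]

theorem odd_choose_two_pow_add {n s : ℕ} (hs : s < 2 ^ n) : Odd ((2 ^ n + s).choose s) := by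
  rw [Nat.add_choose_eq, ← Finset.sum_erase_add _ _
    (mem_antidiagonal.mpr (zero_add s) : (0, s) ∈ _)]
  refine Even.add_odd (Finset.even_sum _ fun ij hij ↦ ?_) (by simp)
  simp only [Finset.mem_erase, mem_antidiagonal] at hij
  refine Even.mul_right (even_iff_two_dvd.mpr (Nat.prime_two.dvd_choose_pow ?_ ?_)) _
  · intro h
    exact hij.1 (Prod.ext h (by simp only; omega))
  · omega

theorem sum_antidiagonal_choose_mul_swap (m : ℕ) (g : ℕ → ℤ) :
    ∑ ij ∈ antidiagonal m, (m.choose ij.1 : ℤ) * g ij.2 =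
      ∑ ij ∈ antidiagonal m, (m.choose ij.1 : ℤ) * g ij.1 := by
  rw [← Finset.Nat.sum_antidiagonal_swap]
  refine Finset.sum_congr rfl fun ij hij ↦ ?_
  simp only [Prod.fst_swap, Prod.snd_swap]
  rw [Nat.choose_symm_of_eq_add (mem_antidiagonal.mp hij).symm]

theorem sum_antidiagonal_choose (m : ℕ) :
    ∑ ij ∈ antidiagonal m, (m.choose ij.1 : ℤ) = 2 ^ m := by
  rw [Finset.Nat.sum_antidiagonal_eq_sum_range_succ_mk]
  exact_mod_cast Nat.sum_range_choose m

theorem sum_antidiagonal_choose_mul_one_sub (m : ℕ) (g : ℕ → ℤ) :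
    ∑ ij ∈ antidiagonal m, (m.choose ij.1 : ℤ) * (1 - g ij.1 - g ij.2) =
      2 ^ m - 2 * ∑ ij ∈ antidiagonal m, (m.choose ij.1 : ℤ) * g ij.2 := by
  simp only [mul_sub, Finset.sum_sub_distrib, mul_one, sum_antidiagonal_choose,
    sum_antidiagonal_choose_mul_swap]
  ring

theorem odd_sum_antidiagonal_choose_mul_ite {n k : ℕ} (h₁ : 2 ^ n < k) (h₂ : k ≤ 2 * 2 ^ n) :
    Odd (∑ ij ∈ antidiagonal k,
      (k.choose ij.1 : ℤ) * if 2 ^ n < ij.2 then 1 else 0) := by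
  obtain ⟨s, rfl⟩ := Nat.exists_eq_add_of_lt h₁
  have h : ∑ ij ∈ antidiagonal (2 ^ n + s + 1),
      ((2 ^ n + s + 1).choose ij.1 : ℤ) * (if 2 ^ n < ij.2 then 1 else 0) =
        ((∑ i ∈ Finset.range (s + 1), (2 ^ n + s + 1).choose i : ℕ) : ℤ) := by
    rw [Finset.Nat.sum_antidiagonal_eq_sum_range_succ_mk]
    simp only [mul_ite, mul_one, mul_zero]
    rw [← Finset.sum_filter, Nat.cast_sum]
    refine Finset.sum_congr ?_ fun _ _ ↦ rfl
    ext i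
    simp only [Finset.mem_filter, Finset.mem_range]
    omega
  rw [h, Int.odd_coe_nat, Nat.odd_iff, sum_range_choose_succ_modEq, ← Nat.odd_iff]
  exact odd_choose_two_pow_add (by omega)

theorem sum_choose_mul_ite_modEq {n k : ℕ} (h₁ : 2 ^ n < k) (h₂ : k ≤ 2 * 2 ^ n) :
    ∑ ij ∈ antidiagonal k, (k.choose ij.1 : ℤ) *
      ((if 1 ≤ ij.1 ∧ ij.1 ≤ 2 ^ n then 1 else 0) *
        if 1 ≤ ij.2 ∧ ij.2 ≤ 2 ^ n then 1 else 0) ≡ 2 [ZMOD 4] := by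
  have h : ∀ ij ∈ antidiagonal k, (k.choose ij.1 : ℤ) *
      ((if 1 ≤ ij.1 ∧ ij.1 ≤ 2 ^ n then 1 else 0) *
        if 1 ≤ ij.2 ∧ ij.2 ≤ 2 ^ n then 1 else 0) = (k.choose ij.1 : ℤ) *
      (1 - (if 2 ^ n < ij.1 then 1 else 0) - (if 2 ^ n < ij.2 then 1 else 0)) := by
    intro ij hij
    rw [mem_antidiagonal] at hij
    congr 1
    split_ifs <;> first | rfl | omega
  rw [Finset.sum_congr rfl h,
    sum_antidiagonal_choose_mul_one_sub k (fun i ↦ if 2 ^ n < i then 1 else 0)]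
  obtain ⟨q, hq⟩ := odd_sum_antidiagonal_choose_mul_ite h₁ h₂
  obtain ⟨k, rfl⟩ : ∃ k', k = k' + 2 := ⟨k - 2, by have := Nat.one_le_two_pow (n := n); omega⟩
  rw [hq, pow_add]
  exact (Int.modEq_iff_dvd.mpr ⟨1 + q - 2 ^ k, by ring⟩)

theorem even_sum_choose_mul_ite {n k : ℕ} (h₁ : 2 ^ n < k) (h₂ : k ≤ 2 * 2 ^ n) :
    Even (∑ ij ∈ antidiagonal k, (k.choose ij.1 : ℤ) *
      ((if 1 ≤ ij.1 ∧ ij.1 ≤ 2 ^ n then 1 else 0) *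
        (ij.1 * if 1 ≤ ij.2 + 1 ∧ ij.2 + 1 ≤ 2 ^ n then 1 else 0))) := by
  obtain ⟨k, rfl⟩ : ∃ k', k = k' + 2 := ⟨k - 2, by have := Nat.one_le_two_pow (n := n); omega⟩
  rw [Finset.Nat.sum_antidiagonal_succ]
  simp only [Nat.cast_zero, zero_mul, mul_zero, zero_add]
  have h : ∀ ij ∈ antidiagonal (k + 1), ((k + 1 + 1).choose (ij.1 + 1) : ℤ) *
      ((if 1 ≤ ij.1 + 1 ∧ ij.1 + 1 ≤ 2 ^ n then 1 else 0) *
        ((ij.1 + 1 : ℕ) * if 1 ≤ ij.2 + 1 ∧ ij.2 + 1 ≤ 2 ^ n then 1 else 0)) =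
      (k + 2) * (((k + 1).choose ij.1 : ℤ) *
      (1 - (if 2 ^ n < ij.1 + 1 then 1 else 0) - (if 2 ^ n < ij.2 + 1 then 1 else 0))) := by
    intro ij hij
    rw [mem_antidiagonal] at hij
    have hc : ((k + 1 + 1 : ℕ) : ℤ) * (k + 1).choose ij.1 =
        (k + 1 + 1).choose (ij.1 + 1) * (ij.1 + 1 : ℕ) := by
      exact_mod_cast Nat.add_one_mul_choose_eq (k + 1) ij.1
    have hi : (if 1 ≤ ij.1 + 1 ∧ ij.1 + 1 ≤ 2 ^ n then 1 else 0) *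
        (if 1 ≤ ij.2 + 1 ∧ ij.2 + 1 ≤ 2 ^ n then 1 else 0) =
        (1 - (if 2 ^ n < ij.1 + 1 then 1 else 0) - (if 2 ^ n < ij.2 + 1 then 1 else 0) : ℤ) := by
      split_ifs <;> first | rfl | omega
    rw [← hi]
    simp only [Nat.cast_add, Nat.cast_one] at hc ⊢
    linear_combination (- (if 1 ≤ ij.1 + 1 ∧ ij.1 + 1 ≤ 2 ^ n then 1 else 0) *
        (if 1 ≤ ij.2 + 1 ∧ ij.2 + 1 ≤ 2 ^ n then 1 else 0) : ℤ) * hc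
  rw [Finset.sum_congr rfl h, ← Finset.mul_sum,
    sum_antidiagonal_choose_mul_one_sub (k + 1) (fun i ↦ if 2 ^ n < i + 1 then 1 else 0), pow_succ']
  exact (((even_two_mul _).sub (even_two_mul _)).mul_left _)

theorem four_mul_newtonCoeff_truncOddIndicator_mul_self (K k : ℕ) :
    4 * newtonCoeff k (truncOddIndicator K * truncOddIndicator K) =
      (-2) ^ k * ∑ ij ∈ antidiagonal k, (k.choose ij.1 : ℤ) *
        ((if 1 ≤ ij.1 ∧ ij.1 ≤ K then 1 else 0) *
          ∑ l ∈ Finset.range (ij.1 + 1), (ij.1.choose l : ℤ) *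
            ((-2) ^ l * if 1 ≤ ij.2 + l ∧ ij.2 + l ≤ K then 1 else 0)) := by
  rw [newtonCoeff_mul, Finset.mul_sum, Finset.mul_sum]
  refine Finset.sum_congr rfl fun ⟨i, j⟩ hij ↦ ?_
  obtain rfl := mem_antidiagonal.mp hij
  dsimp only
  have h₁ := neg_two_mul_newtonCoeff_truncOddIndicator K i
  have h₂ : -2 * ∑ l ∈ Finset.range (i + 1),
        (i.choose l : ℤ) * newtonCoeff (j + l) (truncOddIndicator K) =
      (-2) ^ j * ∑ l ∈ Finset.range (i + 1), (i.choose l : ℤ) *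
        ((-2) ^ l * if 1 ≤ j + l ∧ j + l ≤ K then 1 else 0) := by
    rw [Finset.mul_sum, Finset.mul_sum]
    refine Finset.sum_congr rfl fun l _ ↦ ?_
    rw [mul_left_comm, neg_two_mul_newtonCoeff_truncOddIndicator, pow_add]
    ring
  rw [pow_add]
  linear_combination ((i + j).choose i : ℤ) * (-2 * ∑ l ∈ Finset.range (i + 1),
        (i.choose l : ℤ) * newtonCoeff (j + l) (truncOddIndicator K)) * h₁ +
    ((i + j).choose i : ℤ) * ((-2) ^ i * if 1 ≤ i ∧ i ≤ K then 1 else 0) * h₂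

theorem sum_range_choose_mul_neg_two_pow_modEq (i : ℕ) (g : ℕ → ℤ) :
    ∑ l ∈ Finset.range (i + 1), (i.choose l : ℤ) * ((-2) ^ l * g l) ≡
      g 0 - 2 * (i * g 1) [ZMOD 4] := by
  cases i with
  | zero => simp [Int.ModEq]
  | succ i =>
    rw [Finset.sum_range_succ', Finset.sum_range_succ', Int.modEq_iff_dvd]
    have h : (4 : ℤ) ∣ ∑ l ∈ Finset.range i,
        ((i + 1).choose (l + 1 + 1) : ℤ) * ((-2) ^ (l + 1 + 1) * g (l + 1 + 1)) :=
      Finset.dvd_sum fun l _ ↦ ⟨(i + 1).choose (l + 1 + 1) * ((-2) ^ l * g (l + 1 + 1)), by ring⟩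
    obtain ⟨q, hq⟩ := h
    rw [hq]
    simp only [zero_add, Nat.choose_one_right, Nat.choose_zero_right, Nat.cast_one]
    exact ⟨-q, by ring⟩

theorem two_pow_dvd_newtonCoeff_truncOddIndicator_mul_self_sub {n k : ℕ} (h₁ : 2 ^ n < k)
    (h₂ : k ≤ 2 * 2 ^ n) :
    (2 : ℤ) ^ k ∣ newtonCoeff k (truncOddIndicator (2 ^ n) * truncOddIndicator (2 ^ n)) -
      newtonCoeff k oddIndicator := by
  have h := four_mul_newtonCoeff_truncOddIndicator_mul_self (2 ^ n) k
  have hs : ∑ ij ∈ antidiagonal k, (k.choose ij.1 : ℤ) *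
        ((if 1 ≤ ij.1 ∧ ij.1 ≤ 2 ^ n then 1 else 0) *
          ∑ l ∈ Finset.range (ij.1 + 1), (ij.1.choose l : ℤ) *
            ((-2) ^ l * if 1 ≤ ij.2 + l ∧ ij.2 + l ≤ 2 ^ n then 1 else 0)) ≡ -2 [ZMOD 4] := by
    have hl : ∀ ij ∈ antidiagonal k, (k.choose ij.1 : ℤ) *
        ((if 1 ≤ ij.1 ∧ ij.1 ≤ 2 ^ n then 1 else 0) *
          ∑ l ∈ Finset.range (ij.1 + 1), (ij.1.choose l : ℤ) *
            ((-2) ^ l * if 1 ≤ ij.2 + l ∧ ij.2 + l ≤ 2 ^ n then 1 else 0)) ≡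
        (k.choose ij.1 : ℤ) * ((if 1 ≤ ij.1 ∧ ij.1 ≤ 2 ^ n then 1 else 0) *
          ((if 1 ≤ ij.2 ∧ ij.2 ≤ 2 ^ n then 1 else 0) -
            2 * (ij.1 * if 1 ≤ ij.2 + 1 ∧ ij.2 + 1 ≤ 2 ^ n then 1 else 0))) [ZMOD 4] :=
      fun ij _ ↦ ((sum_range_choose_mul_neg_two_pow_modEq ij.1
        fun l ↦ if 1 ≤ ij.2 + l ∧ ij.2 + l ≤ 2 ^ n then 1 else 0).mul_left _).mul_left _
    refine (Int.ModEq.sum hl).trans ?_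
    obtain ⟨q, hq⟩ := even_sum_choose_mul_ite h₁ h₂
    have h₀ := sum_choose_mul_ite_modEq h₁ h₂
    have h_two (C d e : ℤ) : C * (d * (2 * e)) = 2 * (C * (d * e)) := by ring
    simp only [mul_sub, Finset.sum_sub_distrib, h_two]
    rw [← Finset.mul_sum, hq]
    rw [Int.modEq_iff_dvd] at h₀ ⊢
    obtain ⟨r, hr⟩ := h₀
    exact ⟨r - 1 + q, by linear_combination hr⟩
  obtain ⟨r, hr⟩ := Int.modEq_iff_dvd.mp hs
  obtain ⟨k, rfl⟩ : ∃ k', k = k' + 1 := ⟨k - 1, by omega⟩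
  rw [newtonCoeff_succ_oddIndicator]
  have : newtonCoeff (k + 1) (truncOddIndicator (2 ^ n) * truncOddIndicator (2 ^ n)) - (-2) ^ k =
      (-2) ^ (k + 1) * -r := by
    apply mul_left_cancel₀ (four_ne_zero (α := ℤ))
    rw [mul_sub, h]
    linear_combination -(-2) ^ (k + 1) * hr
  rw [this, neg_pow]
  exact Dvd.dvd.mul_right (Dvd.intro_left _ rfl) _

theorem truncOddIndicator_mul_self_sub_mem (n : ℕ) :
    truncOddIndicator (2 ^ n) * truncOddIndicator (2 ^ n) - oddIndicator ∈
      dyadicSubmodule (2 ^ (n + 1)) := by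
  intro k hk
  rcases le_or_gt k (2 ^ n) with hkn | hkn
  · have h : truncOddIndicator (2 ^ n) * truncOddIndicator (2 ^ n) - oddIndicator =
        (truncOddIndicator (2 ^ n) - oddIndicator) *
          (truncOddIndicator (2 ^ n) + oddIndicator) := by
      linear_combination oddIndicator_mul_self
    rw [h, newtonCoeff_mul, Finset.sum_eq_zero]
    · exact dvd_zero _
    · intro ij hij
      rw [mem_antidiagonal] at hij
      rw [map_sub, newtonCoeff_truncOddIndicator, if_pos (by omega), sub_self, zero_mul, mul_zero]
  · rw [map_sub]
    exact two_pow_dvd_newtonCoeff_truncOddIndicator_mul_self_sub hkn (by rwa [← pow_succ'])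

theorem S_eq_zero_of_lt {n k : ℕ} (h : n < k) : S n k = 0 := by
  induction n generalizing k with
  | zero =>
    cases k with
    | zero => omega
    | succ k => rfl
  | succ n ih =>
    cases k with
    | zero => omega
    | succ k => simp [S, ih (show n < k by omega), ih (show n < k + 1 by omega)]

theorem pow_two_pow_sub_oddIndicator_mem (n : ℕ) :
    (fun x : ℕ ↦ (x : ℤ) ^ 2 ^ n) - oddIndicator ∈ dyadicSubmodule (2 ^ n) := by
  induction n with
  | zero =>
    intro k hk
    rw [map_sub, newtonCoeff_pow]
    rw [pow_zero] at hk
    interval_cases k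
    · simp
    · rw [newtonCoeff_succ_oddIndicator 0]
      simp [S]
  | succ n ih =>
    set f : ℕ → ℤ := fun x ↦ (x : ℤ) ^ 2 ^ n with hf
    set e := truncOddIndicator (2 ^ n)
    have hp : f - e ∈ dyadicSubmodule (2 ^ (n + 1)) := by
      intro k _
      rw [map_sub, newtonCoeff_truncOddIndicator]
      split_ifs with hkn
      · rw [← map_sub]
        exact ih k hkn
      · rw [hf, newtonCoeff_pow, S_eq_zero_of_lt (not_le.mp hkn)]
        simp
    have h : (fun x : ℕ ↦ (x : ℤ) ^ 2 ^ (n + 1)) - oddIndicator =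
        (e * e - oddIndicator) + ((2 : ℤ) • e) * (f - e) + (f - e) * (f - e) := by
      ext x
      simp only [hf, Pi.sub_apply, Pi.add_apply, Pi.mul_apply, Pi.smul_apply, smul_eq_mul, pow_succ,
        pow_mul]
      ring
    rw [h]
    exact add_mem (add_mem (truncOddIndicator_mul_self_sub_mem n)
      (mul_mem_dyadicSubmodule (two_smul_truncOddIndicator_mem _ _) hp))
      (mul_mem_dyadicSubmodule hp hp)

theorem oddIndicator_mul_pow_sub_mem {m N : ℕ} (hN : m ≤ N)
    (h : (fun x : ℕ ↦ (x : ℤ) ^ N) - oddIndicator ∈ dyadicSubmodule m) :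
    oddIndicator * ((fun x : ℕ ↦ (x : ℤ) ^ N) - oddIndicator) ∈ dyadicSubmodule m := by
  have he : (1 - oddIndicator) * (fun x : ℕ ↦ (x : ℤ) ^ N) ∈ dyadicSubmodule m := by
    refine fun k hk ↦ (pow_dvd_pow 2 (hk.trans hN)).trans
      (newtonCoeff_dvd_of_forall_dvd (fun x ↦ ?_) k)
    rcases Nat.mod_two_eq_zero_or_one x with hx | hx
    · refine Dvd.dvd.mul_left (pow_dvd_pow_of_dvd ?_ N) _
      exact_mod_cast Nat.dvd_of_mod_eq_zero hx
    · simp [oddIndicator, hx]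
  convert sub_mem h he using 1
  linear_combination -oddIndicator_mul_self

theorem pow_mul_two_pow_sub_oddIndicator_mem (n : ℕ) {c : ℕ} (hc : 0 < c) :
    (fun x : ℕ ↦ (x : ℤ) ^ (c * 2 ^ n)) - oddIndicator ∈ dyadicSubmodule (2 ^ n) := by
  have h₁ := pow_two_pow_sub_oddIndicator_mem n
  induction c, hc using Nat.le_induction with
  | base => simpa using h₁
  | succ c hc ih =>
    set f : ℕ → ℤ := fun x ↦ (x : ℤ) ^ (c * 2 ^ n) with hf
    set g : ℕ → ℤ := fun x ↦ (x : ℤ) ^ 2 ^ n with hg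
    have h : (fun x : ℕ ↦ (x : ℤ) ^ ((c + 1) * 2 ^ n)) = f * g := by
      ext x
      simp only [hf, hg, Pi.mul_apply, add_mul, one_mul, pow_add]
    have h' : f * g - oddIndicator = oddIndicator * (f - oddIndicator) +
        oddIndicator * (g - oddIndicator) + (f - oddIndicator) * (g - oddIndicator) := by
      linear_combination oddIndicator_mul_self
    rw [h, h']
    exact add_mem (add_mem (oddIndicator_mul_pow_sub_mem (Nat.le_mul_of_pos_left _ hc) ih)
      (oddIndicator_mul_pow_sub_mem le_rfl h₁)) (mul_mem_dyadicSubmodule ih h₁)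

theorem stmt16 (k n c : ℕ) (hc : 0 < c) (hn : 0 < n) (hk0 : 1 ≤ k) (hk : k ≤ 2 ^ n) :
    padicValNat 2 (S (c * 2 ^ n) k) = s₂ k - 1 := by
  have h := pow_mul_two_pow_sub_oddIndicator_mem n hc k hk
  rw [map_sub, newtonCoeff_pow] at h
  have hd : k.factorial ≠ 0 := k.factorial_ne_zero
  have hL := sub_one_mul_padicValNat_factorial (p := 2) k
  have hs := Nat.digit_sum_le 2 k
  obtain ⟨m, rfl⟩ : ∃ m, k = m + 1 := ⟨k - 1, by omega⟩
  rw [newtonCoeff_succ_oddIndicator] at h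
  obtain ⟨q, hq⟩ := h
  have hq' : (((m + 1).factorial * S (c * 2 ^ n) (m + 1) : ℕ) : ℤ) =
      2 ^ m * ((-1) ^ m + 2 * q) := by
    rw [neg_pow] at hq
    push_cast
    linear_combination hq
  have hodd : Odd ((-1 : ℤ) ^ m + 2 * q) := (Odd.pow (by decide)).add_even (even_two_mul q)
  have hv : padicValNat 2 ((m + 1).factorial * S (c * 2 ^ n) (m + 1)) = m := by
    have h₀ : (-1 : ℤ) ^ m + 2 * q ≠ 0 := fun h ↦ by simp [h] at hodd
    rw [← padicValInt.of_nat, hq', padicValInt.mul (by positivity) h₀,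
      padicValInt.eq_zero_of_not_dvd (z := (-1) ^ m + 2 * q)
        (fun h ↦ Int.not_even_iff_odd.mpr hodd (even_iff_two_dvd.mpr h)), add_zero]
    have : (2 : ℤ) ^ m = ((2 ^ m : ℕ) : ℤ) := by push_cast; rfl
    rw [this, padicValInt.of_nat, padicValNat.prime_pow]
  have hS : S (c * 2 ^ n) (m + 1) ≠ 0 := by
    intro h₀
    rw [h₀, mul_zero, Nat.cast_zero, eq_comm, mul_eq_zero] at hq'
    rcases hq' with h' | h'
    · exact absurd h' (by positivity)
    · simp [h'] at hodd
  rw [padicValNat.mul hd hS] at hv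
  unfold s₂
  omega
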